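/- Let x, y ∈ H be unit vectors with ⟨x, y⟩ = 0, and let x⊗x and y⊗y denote the rank-one operators (x⊗x)(z) = ⟨z, x⟩x and (y⊗y)(z) = ⟨z, y⟩y. Then for every ε ∈ [0,1), x⊗x ⊥ε_ω y⊗y. -/

import Mathlib

open Filter Topology
open scoped InnerProductSpace

variable {H : Type*} [NormedAddCommGroup H] [InnerProductSpace ℂ H] [CompleteSpace H]

/-- The numerical radius of a bounded operator `T`:
`ω(T) = sup {|⟨Tx, x⟩| : ‖x‖ = 1}`. -/
noncomputable def nrad (T : H →L[ℂ] H) : ℝ :=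
  sSup {r : ℝ | ∃ x : H, ‖x‖ = 1 ∧ r = ‖⟪x, T x⟫_ℂ‖}

/-- Approximate numerical-radius (Birkhoff) orthogonality:
`T ⊥ε_ω S` iff `ω(T + λS)² ≥ ω(T)² − 2ε ω(T) ω(λS)` for all `λ ∈ ℂ`. -/
def NradOrth (ε : ℝ) (T S : H →L[ℂ] H) : Prop :=
  ∀ μ : ℂ, nrad T ^ 2 - 2 * ε * nrad T * nrad (μ • S) ≤ nrad (T + μ • S) ^ 2

theorem norm_inner_apply_le_opNorm (T : H →L[ℂ] H) {z : H} (hz : ‖z‖ = 1) :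
    ‖⟪z, T z⟫_ℂ‖ ≤ ‖T‖ :=
  calc ‖⟪z, T z⟫_ℂ‖ ≤ ‖z‖ * ‖T z‖ := norm_inner_le_norm z (T z)
    _ ≤ ‖T‖ := by simpa [hz] using T.le_opNorm z

theorem nrad_nonneg (T : H →L[ℂ] H) : 0 ≤ nrad T :=
  Real.sSup_nonneg (by rintro _ ⟨z, -, rfl⟩; exact norm_nonneg _)

theorem nrad_le_opNorm (T : H →L[ℂ] H) : nrad T ≤ ‖T‖ :=
  Real.sSup_le (by rintro _ ⟨z, hz, rfl⟩; exact norm_inner_apply_le_opNorm T hz) (norm_nonneg T)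

theorem norm_inner_apply_le_nrad (T : H →L[ℂ] H) {z : H} (hz : ‖z‖ = 1) :
    ‖⟪z, T z⟫_ℂ‖ ≤ nrad T :=
  le_csSup ⟨‖T‖, by rintro _ ⟨w, hw, rfl⟩; exact norm_inner_apply_le_opNorm T hw⟩ ⟨z, hz, rfl⟩

/-- If `x` and `y` are orthogonal unit vectors, then for every `ε ∈ [0,1)`
the rank-one operator `x⊗x : z ↦ ⟨z, x⟩x` is approximately numerical-radius orthogonal
to `y⊗y : z ↦ ⟨z, y⟩y`. -/
theorem nradOrth_rankOne_of_orthogonal (x y : H) (hx : ‖x‖ = 1) (hy : ‖y‖ = 1)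
    (hxy : ⟪x, y⟫_ℂ = 0) (ε : ℝ) (hε0 : 0 ≤ ε) (hε1 : ε < 1) :
    NradOrth ε ((innerSL ℂ x).smulRight x) ((innerSL ℂ y).smulRight y) := by
  intro μ
  have hT : nrad ((innerSL ℂ x).smulRight x) ≤ 1 := by
    simpa [ContinuousLinearMap.norm_smulRight_apply, hx] using
      nrad_le_opNorm ((innerSL ℂ x).smulRight x)
  have hsum : 1 ≤ nrad ((innerSL ℂ x).smulRight x + μ • (innerSL ℂ y).smulRight y) := by
    simpa [inner_add_right, inner_smul_right, hxy, inner_self_eq_norm_sq_to_K, hx] using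
      norm_inner_apply_le_nrad ((innerSL ℂ x).smulRight x + μ • (innerSL ℂ y).smulRight y) hx
  have hT0 := nrad_nonneg ((innerSL ℂ x).smulRight x)
  have hS0 := nrad_nonneg (μ • (innerSL ℂ y).smulRight y)
  calc _ ≤ nrad ((innerSL ℂ x).smulRight x) ^ 2 := sub_le_self _ (by positivity)
    _ ≤ nrad ((innerSL ℂ x).smulRight x + μ • (innerSL ℂ y).smulRight y) ^ 2 := by
      gcongr
      exact hT.trans hsum
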